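/- Let h = 2n+1 be an odd integer with n ≥ 1, let σ be an h-bar-core and let 0 ≤ i ≤ n. Then: (1) σ does not have both an addable i-node and a removable i-node; (2) ψ_i(σ) is an h-bar-core; (3) if τ is an h-bar-core with [σ] strictly contained in [τ] such that every node of [τ]∖[σ] has residue i, then τ = ψ_i(σ). -/

import Mathlib

/-- A partition: a weakly decreasing sequence of non-negative integers with
finite sum (finitely many nonzero parts), indexed from 0 (so `parts 0` is λ₁). -/
structure BPartition where
  parts : ℕ →₀ ℕ
  antitone : ∀ r, parts (r + 1) ≤ parts r

namespace BPartition

/-- The multiset of positive parts of a partition. -/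
def partsM (lam : BPartition) : Multiset ℕ :=
  lam.parts.support.val.map (fun r => lam.parts r)

/-- The Young diagram: nodes `(r, c)` with rows indexed from 0 and columns from 1. -/
def diagram (lam : BPartition) : Set (ℕ × ℕ) :=
  {x | 1 ≤ x.2 ∧ x.2 ≤ lam.parts x.1}

/-- A partition is strict if λ_r > λ_{r+1} whenever λ_r > 0. -/
def IsStrict (lam : BPartition) : Prop :=
  ∀ r, 0 < lam.parts r → lam.parts (r + 1) < lam.parts r

/-- A partition is h-strict if each part is either strictly bigger than the next,
or positive and divisible by h, or zero. -/
def IsHStrict (h : ℕ) (lam : BPartition) : Prop :=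
  ∀ r, lam.parts (r + 1) < lam.parts r ∨ (0 < lam.parts r ∧ h ∣ lam.parts r) ∨ lam.parts r = 0

/-- An h-strict partition is restricted if for every r either λ_{r+1} > λ_r − h,
or λ_{r+1} = λ_r − h and h does not divide λ_r. -/
def IsRestricted (h : ℕ) (lam : BPartition) : Prop :=
  ∀ r, lam.parts r < lam.parts (r + 1) + h ∨
    (lam.parts (r + 1) + h = lam.parts r ∧ ¬ h ∣ lam.parts r)

/-- The residue of a node in column c (1-indexed): the smaller of the residues of
c − 1 and of −c modulo h. -/
def colRes (h c : ℕ) : ℕ := min ((c - 1) % h) ((h - c % h) % h)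

/-- `x` is an addable i-node of `lam`. -/
def Addable (h i : ℕ) (lam : BPartition) (x : ℕ × ℕ) : Prop :=
  colRes h x.2 = i ∧ x ∉ diagram lam ∧
  ∃ nu : BPartition, IsHStrict h nu ∧ diagram lam ⊆ diagram nu ∧ x ∈ diagram nu ∧
    ∀ y ∈ diagram nu, y ∉ diagram lam → colRes h y.2 = i

/-- `x` is a removable i-node of `lam`. -/
def Removable (h i : ℕ) (lam : BPartition) (x : ℕ × ℕ) : Prop :=
  x ∈ diagram lam ∧
  ∃ mu : BPartition, IsHStrict h mu ∧ diagram mu ⊆ diagram lam ∧ x ∉ diagram mu ∧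
    ∀ y ∈ diagram lam, y ∉ diagram mu → colRes h y.2 = i

/-- Removal of a single h-bar from `lam` giving `mu`, recording the value `v`:
either a part `v ≥ h` is replaced by `v − h` (deleted if `v = h`), or two parts
summing to `h` are deleted, in which case `v` is the larger of the two. -/
def barStepRec (h : ℕ) (lam mu : BPartition) (v : ℕ) : Prop :=
  IsHStrict h mu ∧
  ((v = h ∧ v ∈ partsM lam ∧ partsM mu = (partsM lam).erase v) ∨
   (h < v ∧ v ∈ partsM lam ∧ partsM mu = (v - h) ::ₘ (partsM lam).erase v) ∨
   (∃ a b : ℕ, a + b = h ∧ a ∈ partsM lam ∧ b ∈ (partsM lam).erase a ∧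
      v = max a b ∧ partsM mu = ((partsM lam).erase a).erase b))

/-- Removal of a single h-bar. -/
def barStep (h : ℕ) (lam mu : BPartition) : Prop :=
  ∃ v, barStepRec h lam mu v

/-- An h-bar-core: an h-strict partition from which no h-bar can be removed. -/
def IsBarCore (h : ℕ) (lam : BPartition) : Prop :=
  IsHStrict h lam ∧ ∀ mu, ¬ barStep h lam mu

/-- A chain of `w` h-bar removals from `lam` down to `mu`. -/
def barChain (h : ℕ) : ℕ → BPartition → BPartition → Prop
  | 0, lam, mu => lam = mu
  | w + 1, lam, mu => ∃ nu, barStep h lam nu ∧ barChain h w nu mu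

/-- `lam ∈ P_{τ,w}`: `lam` is h-strict with h-bar-core `tau` and h-bar-weight `w`. -/
def InBlock (h : ℕ) (tau : BPartition) (w : ℕ) (lam : BPartition) : Prop :=
  IsHStrict h lam ∧ IsBarCore h tau ∧ barChain h w lam tau

/-- The left-to-right order on node positions along the edge of a Young diagram:
smaller column first; within a column, larger row first. -/
def posLE (x y : ℕ × ℕ) : Prop := x.2 < y.2 ∨ (x.2 = y.2 ∧ y.1 ≤ x.1)

/-- `x` is a normal i-node: a removable i-node surviving (as a − sign) in the
reduced i-signature; equivalently, every window of the i-signature ending at `x`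
contains strictly more removable than addable i-nodes. -/
def Normal (h i : ℕ) (lam : BPartition) (x : ℕ × ℕ) : Prop :=
  Removable h i lam x ∧ ∀ z : ℕ × ℕ, posLE z x →
    Set.ncard {y | Addable h i lam y ∧ posLE z y ∧ posLE y x} <
      Set.ncard {y | Removable h i lam y ∧ posLE z y ∧ posLE y x}

/-- `x` is a conormal i-node: an addable i-node surviving (as a + sign) in the
reduced i-signature. -/
def Conormal (h i : ℕ) (lam : BPartition) (x : ℕ × ℕ) : Prop :=
  Addable h i lam x ∧ ∀ z : ℕ × ℕ, posLE x z →
    Set.ncard {y | Removable h i lam y ∧ posLE x y ∧ posLE y z} <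
      Set.ncard {y | Addable h i lam y ∧ posLE x y ∧ posLE y z}

/-- The node set of ψ_i(λ): add the leftmost s − r conormal i-nodes if s ≥ r,
remove the rightmost r − s normal i-nodes if r > s, where r = #normal and
s = #conormal i-nodes. -/
noncomputable def psiSet (h i : ℕ) (lam : BPartition) : Set (ℕ × ℕ) :=
  if Set.ncard {x | Normal h i lam x} ≤ Set.ncard {x | Conormal h i lam x} then
    diagram lam ∪ {x | Conormal h i lam x ∧
      Set.ncard {y | Conormal h i lam y ∧ posLE y x} ≤
        Set.ncard {x | Conormal h i lam x} - Set.ncard {x | Normal h i lam x}}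
  else
    diagram lam \ {x | Normal h i lam x ∧
      Set.ncard {y | Normal h i lam y ∧ posLE x y} ≤
        Set.ncard {x | Normal h i lam x} - Set.ncard {x | Conormal h i lam x}}

open Classical in
/-- The involution ψ_i. -/
noncomputable def psi (h i : ℕ) (lam : BPartition) : BPartition :=
  if hex : ∃ mu : BPartition, diagram mu = psiSet h i lam then hex.choose else lam

/-- The set of occupied positions of the abacus display of a strict partition. -/
def abacus (lam : BPartition) : Set ℤ :=
  {a | a = 0 ∨ (0 < a ∧ a.toNat ∈ partsM lam) ∨ (a < 0 ∧ (-a).toNat ∉ partsM lam)}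

/-- The dominance order: λ ⊴ μ. -/
def domLE (lam mu : BPartition) : Prop :=
  ∀ r, ∑ s ∈ Finset.range r, lam.parts s ≤ ∑ s ∈ Finset.range r, mu.parts s

/-- Strict dominance: λ ◁ μ. -/
def domLT (lam mu : BPartition) : Prop := domLE lam mu ∧ lam ≠ mu

/-- Lexicographic order: λ <lex μ. -/
def lexLT (lam mu : BPartition) : Prop :=
  ∃ r, lam.parts r < mu.parts r ∧ ∀ s < r, lam.parts s = mu.parts s

/-- Colexicographic order: λ <colex μ. -/
def colexLT (lam mu : BPartition) : Prop :=
  ∃ r, mu.parts r < lam.parts r ∧ ∀ s, r < s → lam.parts s = mu.parts s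

/-- λ ↔ᵢ μ: every node of the symmetric difference of the diagrams has residue i. -/
def Link (h i : ℕ) (lam mu : BPartition) : Prop :=
  ∀ x : ℕ × ℕ, x ∈ (diagram lam \ diagram mu) ∪ (diagram mu \ diagram lam) →
    colRes h x.2 = i

/-- `a ≤ b` are the bar positions of `lam ∈ P_{τ,2}`: the values recorded by
some two-step removal of h-bars from `lam` down to `tau`. -/
def BarPositions (h : ℕ) (tau lam : BPartition) (a b : ℕ) : Prop :=
  a ≤ b ∧ ∃ (nu : BPartition) (v₁ v₂ : ℕ), barStepRec h lam nu v₁ ∧ barStepRec h nu tau v₂ ∧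
    ({a, b} : Multiset ℕ) = {v₁, v₂}

/-- The leg length of the bar of `lam ∈ P_{τ,2}` at bar position `c`. -/
noncomputable def legLen (h : ℕ) (tau lam : BPartition) (c : ℕ) : ℕ :=
  if h ≤ c then Set.ncard {x : ℕ | c - h < x ∧ x < c ∧ x ∈ partsM lam ∧ x ∈ partsM tau}
  else (h - c) + Set.ncard {x : ℕ | h - c < x ∧ x < c ∧ x ∈ partsM lam ∧ x ∈ partsM tau}

/-- ∂λ: the absolute difference of the two leg lengths of `lam`, whose bar
positions are `a ≤ b`. -/
noncomputable def ddd (h : ℕ) (tau lam : BPartition) (a b : ℕ) : ℕ :=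
  max (legLen h tau lam a) (legLen h tau lam b) - min (legLen h tau lam a) (legLen h tau lam b)

inductive Colour | black | white | grey
deriving DecidableEq

/-- β(τ): the number of parts of τ less than h. -/
def betaCount (h : ℕ) (tau : BPartition) : ℕ :=
  Multiset.card ((partsM tau).filter (fun x => x < h))

/-- The leg length of a 2h-bar of `lam` with larger bar position `b`. -/
noncomputable def legLen2 (h : ℕ) (tau lam : BPartition) (b : ℕ) : ℕ :=
  if 2 * h ≤ b then Set.ncard {x : ℕ | b - 2 * h < x ∧ x < b ∧ x ∈ partsM lam ∧ x ∈ partsM tau}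
  else (2 * h - b) + Set.ncard {x : ℕ | 2 * h - b < x ∧ x < b ∧ x ∈ partsM lam ∧ x ∈ partsM tau}

/-- The colour of `lam ∈ P_{τ,2}` with bar positions `a ≤ b`. -/
noncomputable def colour (h : ℕ) (tau lam : BPartition) (a b : ℕ) : Colour :=
  if 2 ≤ ddd h tau lam a b then Colour.grey
  else if ddd h tau lam a b = 1 then
    if h < b then Colour.grey
    else if (min (legLen h tau lam a) (legLen h tau lam b) + betaCount h tau) % 2 = 1 then
      Colour.black else Colour.white
  else
    if b = a + h ∨ a + b = 2 * h then
      if (legLen2 h tau lam b + 2 * betaCount h tau) % 4 = 0 ∨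
         (legLen2 h tau lam b + 2 * betaCount h tau) % 4 = 3 then Colour.black
      else Colour.white
    else
      if (legLen h tau lam a + betaCount h tau) % 2 = 1 then Colour.black else Colour.white

end BPartition

namespace BPartition

def SS (lam : BPartition) (v : ℕ) : Prop := v ≠ 0 ∧ ∃ r, lam.parts r = v

theorem anti (lam : BPartition) {r s : ℕ} (hrs : r ≤ s) : lam.parts s ≤ lam.parts r :=
  antitone_nat_of_succ_le lam.antitone hrs

theorem mem_partsM (lam : BPartition) (v : ℕ) : v ∈ partsM lam ↔ SS lam v := by
  unfold partsM SS
  simp only [Multiset.mem_map, Finset.mem_val, Finsupp.mem_support_iff]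
  constructor
  · rintro ⟨r, h1, h2⟩; exact ⟨h2 ▸ h1, r, h2⟩
  · rintro ⟨h1, r, h2⟩; exact ⟨r, h2 ▸ h1, h2⟩

theorem bp_ext {a b : BPartition} (H : ∀ r, a.parts r = b.parts r) : a = b := by
  cases a; cases b; congr; ext r; exact H r

theorem mem_diag (lam : BPartition) (r c : ℕ) :
    (r, c) ∈ diagram lam ↔ 1 ≤ c ∧ c ≤ lam.parts r := Iff.rfl

theorem diag_sub {a b : BPartition} : diagram a ⊆ diagram b ↔ ∀ r, a.parts r ≤ b.parts r := by
  constructor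
  · intro H r
    by_contra hc
    have := @H (r, a.parts r) ⟨by simp; omega, le_refl _⟩
    have := this.2
    simp at this
    omega
  · rintro H ⟨r, c⟩ ⟨h1, h2⟩
    exact ⟨h1, h2.trans (H r)⟩

theorem diag_inj {a b : BPartition} (H : diagram a = diagram b) : a = b :=
  bp_ext fun r => le_antisymm (diag_sub.1 H.subset r) (diag_sub.1 H.symm.subset r)

theorem diag_fin (a : BPartition) : (diagram a).Finite := by
  apply Set.Finite.subset
    ((a.parts.support.finite_toSet).prod (Finset.range (a.parts 0 + 1)).finite_toSet)
  rintro ⟨r, c⟩ ⟨h1, h2⟩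
  simp only [] at h1 h2
  have := anti a (Nat.zero_le r)
  simp
  omega

/-- construct a partition from a function -/
theorem exists_mk (f : ℕ → ℕ) (ha : ∀ r, f (r + 1) ≤ f r) (N : ℕ) (hN : ∀ r, N ≤ r → f r = 0) :
    ∃ lam : BPartition, ∀ r, lam.parts r = f r := by
  refine ⟨⟨Finsupp.onFinset (Finset.range N) f ?_, ?_⟩, ?_⟩
  · intro a h
    by_contra hc
    simp at hc
    exact h (hN a hc)
  · intro r; simpa using ha r
  · intro r; simp

theorem ev_zero (lam : BPartition) : ∃ N, ∀ r, N ≤ r → lam.parts r = 0 := by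
  obtain ⟨N, hN⟩ := lam.parts.support.exists_nat_subset_range
  refine ⟨N, fun r hr => ?_⟩
  by_contra hc
  have := hN (Finsupp.mem_support_iff.2 hc)
  simp at this
  omega

theorem psi_up {h i : ℕ} {σ τ : BPartition} (hR : ∀ x, ¬ Removable h i σ x)
    (hA : ∀ x, Addable h i σ x ↔ x ∈ diagram τ ∧ x ∉ diagram σ)
    (hs : diagram σ ⊆ diagram τ) : psi h i σ = τ := by
  have hfin : {x | Addable h i σ x}.Finite :=
    (diag_fin τ).subset fun x hx => ((hA x).1 hx).1
  have hN : {x | Normal h i σ x} = ∅ := by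
    ext x; simp only [Set.mem_ofPred_eq, Set.mem_empty_iff_false, iff_false]
    exact fun hx => hR x hx.1
  have hC : ∀ x, Conormal h i σ x ↔ Addable h i σ x := by
    intro x
    refine ⟨fun hx => hx.1, fun hx => ⟨hx, fun z hz => ?_⟩⟩
    have : {y | Removable h i σ y ∧ posLE x y ∧ posLE y z} = ∅ := by
      ext y; simp [hR y]
    rw [this, Set.ncard_empty, Set.ncard_pos (hfin.subset fun y hy => hy.1)]
    exact ⟨x, hx, Or.inr ⟨rfl, le_refl _⟩, hz⟩
  have hset : psiSet h i σ = diagram τ := by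
    unfold psiSet
    simp only [hN, Set.ncard_empty, Nat.zero_le, if_true, hC, Nat.sub_zero]
    ext x
    simp only [Set.mem_union, Set.mem_ofPred_eq]
    constructor
    · rintro (hx | ⟨hx, -⟩)
      · exact hs hx
      · exact ((hA x).1 hx).1
    · intro hx
      by_cases hx' : x ∈ diagram σ
      · exact Or.inl hx'
      · exact Or.inr ⟨(hA x).2 ⟨hx, hx'⟩, Set.ncard_le_ncard (fun y hy => hy.1) hfin⟩
  have hex : ∃ mu : BPartition, diagram mu = psiSet h i σ := ⟨τ, hset.symm⟩
  unfold psi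
  rw [dif_pos hex]
  exact diag_inj (hex.choose_spec.trans hset)

theorem psi_down {h i : ℕ} {σ τ : BPartition} (hA : ∀ x, ¬ Addable h i σ x)
    (hR : ∀ x, Removable h i σ x ↔ x ∈ diagram σ ∧ x ∉ diagram τ)
    (hs : diagram τ ⊆ diagram σ) : psi h i σ = τ := by
  have hfin : {x | Removable h i σ x}.Finite :=
    (diag_fin σ).subset fun x hx => ((hR x).1 hx).1
  have hN : {x | Conormal h i σ x} = ∅ := by
    ext x; simp only [Set.mem_ofPred_eq, Set.mem_empty_iff_false, iff_false]
    exact fun hx => hA x hx.1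
  have hC : ∀ x, Normal h i σ x ↔ Removable h i σ x := by
    intro x
    refine ⟨fun hx => hx.1, fun hx => ⟨hx, fun z hz => ?_⟩⟩
    have : {y | Addable h i σ y ∧ posLE z y ∧ posLE y x} = ∅ := by
      ext y; simp [hA y]
    rw [this, Set.ncard_empty, Set.ncard_pos (hfin.subset fun y hy => hy.1)]
    exact ⟨x, hx, hz, Or.inr ⟨rfl, le_refl _⟩⟩
  have hN' : ∀ x, ¬ Conormal h i σ x := fun x hx => hA x hx.1
  have hset : psiSet h i σ = diagram τ := by
    unfold psiSet
    simp only [hN, Set.ncard_empty, hC, Nat.sub_zero]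
    split_ifs with hc
    · have h0 : {x | Removable h i σ x} = ∅ := by
        rw [← Set.ncard_eq_zero hfin]; omega
      ext x
      simp only [Set.mem_union, Set.mem_ofPred_eq, hN' x, false_and, or_false]
      refine ⟨fun hx => ?_, fun hx => hs hx⟩
      by_contra hx'
      have : x ∈ {x | Removable h i σ x} := (hR x).2 ⟨hx, hx'⟩
      rw [h0] at this
      exact this
    · ext x
      simp only [Set.mem_sdiff, Set.mem_ofPred_eq]
      constructor
      · rintro ⟨hx, hx2⟩
        by_contra hx'
        exact hx2 ⟨(hR x).2 ⟨hx, hx'⟩, Set.ncard_le_ncard (fun y hy => hy.1) hfin⟩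
      · intro hx
        exact ⟨hs hx, fun hx2 => ((hR x).1 hx2.1).2 hx⟩
  have hex : ∃ mu : BPartition, diagram mu = psiSet h i σ := ⟨τ, hset.symm⟩
  unfold psi
  rw [dif_pos hex]
  exact diag_inj (hex.choose_spec.trans hset)

theorem exists_ofM (M : Multiset ℕ) (h0 : 0 ∉ M) : ∃ lam : BPartition, partsM lam = M ∧
    ∀ r, 0 < lam.parts r → lam.parts (r + 1) = lam.parts r → 2 ≤ M.count (lam.parts r) := by
  set l := M.sort (· ≥ ·) with hl
  have hsort : l.Pairwise (· ≥ ·) := Multiset.pairwise_sort M (· ≥ ·)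
  have hlM : (l : Multiset ℕ) = M := Multiset.sort_eq M (· ≥ ·)
  have hget : ∀ r (hr : r < l.length), l.getD r 0 = l[r] := by
    intro r hr; simp [hr]
  obtain ⟨lam, hlam⟩ := exists_mk (fun r => l.getD r 0) (by
    intro r
    by_cases hr : r + 1 < l.length
    · rw [hget _ hr, hget r (by omega)]
      exact List.pairwise_iff_getElem.1 hsort r (r+1) (by omega) hr (by omega)
    · rw [List.getD_eq_default _ _ (by omega)]; omega) l.length (by
    intro r hr
    exact List.getD_eq_default _ _ hr)
  have hmem : ∀ r (hr : r < l.length), l[r] ≠ 0 := by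
    intro r hr h
    apply h0
    rw [← hlM, Multiset.mem_coe, ← h]
    exact List.getElem_mem hr
  have hsup : lam.parts.support = Finset.range l.length := by
    ext r
    rw [Finsupp.mem_support_iff, hlam, Finset.mem_range]
    constructor
    · intro h
      by_contra hc
      exact h (List.getD_eq_default _ _ (by omega))
    · intro h; rw [hget r h]; exact hmem r h
  refine ⟨lam, ?_, ?_⟩
  · unfold partsM
    rw [hsup, ← hlM]
    simp only [hlam, Finset.range_val, Multiset.range, Multiset.map_coe, Multiset.coe_eq_coe]
    apply List.Perm.of_eq
    apply List.ext_getElem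
    · simp
    · intro k h1 h2
      simp [h2]
  · intro r hr he
    rw [← hlM, Multiset.coe_count, ← List.duplicate_iff_two_le_count,
      List.duplicate_iff_exists_distinct_get]
    have h1 : r + 1 < l.length := by
      by_contra hc
      rw [← he, hlam, List.getD_eq_default _ _ (by omega)] at hr
      omega
    refine ⟨⟨r, by omega⟩, ⟨r+1, h1⟩, by simp, ?_, ?_⟩
    · rw [hlam, hget r (by omega)]; rfl
    · rw [← he, hlam, hget _ h1]; rfl

theorem count_le {h : ℕ} {lam : BPartition} (hs : IsHStrict h lam) {v : ℕ} (hv : ¬ h ∣ v) :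
    (partsM lam).count v ≤ 1 := by
  unfold partsM
  rw [Multiset.count_map]
  have : (Multiset.filter (fun a => v = lam.parts a) lam.parts.support.val) =
    (lam.parts.support.filter (fun a => v = lam.parts a)).val := rfl
  rw [this, Finset.card_val, Finset.card_le_one]
  have key : ∀ a b, a < b → v = lam.parts a → v = lam.parts b → False := by
    intro a b hab ha hb
    have h1 := anti lam (show a + 1 ≤ b by omega)
    have h2 : v ≠ 0 := by rintro rfl; simp at hv
    rcases hs a with h3 | h3 | h3
    · omega
    · exact hv (ha ▸ h3.2)
    · omega
  intro a ha b hb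
  simp only [Finset.mem_filter] at ha hb
  rcases lt_trichotomy a b with hab | hab | hab
  · exact (key a b hab ha.2 hb.2).elim
  · exact hab
  · exact (key b a hab hb.2 ha.2).elim

structure Core (h : ℕ) (lam : BPartition) : Prop where
  strict : ∀ r, 0 < lam.parts r → lam.parts (r + 1) < lam.parts r
  nd : ∀ v, SS lam v → v % h ≠ 0
  down : ∀ v, SS lam v → h < v → SS lam (v - h)
  sum : ∀ u v, SS lam u → SS lam v → u + v ≠ h

theorem exists_hs {h : ℕ} (M : Multiset ℕ) (h0 : 0 ∉ M)
    (hc : ∀ v, ¬ h ∣ v → M.count v ≤ 1) :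
    ∃ lam : BPartition, partsM lam = M ∧ IsHStrict h lam := by
  obtain ⟨lam, h1, h2⟩ := exists_ofM M h0
  refine ⟨lam, h1, fun r => ?_⟩
  by_contra hcon
  push Not at hcon
  obtain ⟨ha, hb, hcc⟩ := hcon
  have hp : 0 < lam.parts r := by omega
  have := h2 r hp (le_antisymm (lam.antitone r) ha)
  have := hc _ (hb hp)
  omega

theorem core_of {h : ℕ} (hh : h % 2 = 1) {lam : BPartition} (H : IsBarCore h lam) :
    Core h lam := by
  obtain ⟨hs, hno⟩ := H
  have hcl := fun v (hv : ¬ h ∣ v) => count_le hs hv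
  have hz : 0 ∉ partsM lam := by rw [mem_partsM]; exact fun h => h.1 rfl
  have step2 : ∀ v, SS lam v → h < v → (h ∣ v ∨ SS lam (v - h)) := by
    intro v hv hlt
    by_contra hc
    push Not at hc
    obtain ⟨mu, e, hmu⟩ := exists_hs (h := h) ((v - h) ::ₘ (partsM lam).erase v) (by
      simp only [Multiset.mem_cons, not_or]
      exact ⟨by omega, fun hm => hz (Multiset.mem_of_mem_erase hm)⟩) (by
      intro u hu
      rw [Multiset.count_cons]
      have h1 : ((partsM lam).erase v).count u ≤ (partsM lam).count u :=
        Multiset.count_le_of_le u (Multiset.erase_le _ _)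
      split_ifs with hu'
      · have : (partsM lam).count u = 0 := by
          rw [Multiset.count_eq_zero, mem_partsM, hu']; exact hc.2
        omega
      · have := hcl u hu
        omega)
    exact hno mu ⟨v, hmu, Or.inr (Or.inl ⟨hlt, (mem_partsM _ _).2 hv, e⟩)⟩
  have nd : ∀ v, SS lam v → ¬ h ∣ v := by
    intro v hv hd
    have hle : h ≤ v := Nat.le_of_dvd (by have := hv.1; omega) hd
    have hcl' : ∀ u, ¬ h ∣ u → ((partsM lam).erase v).count u ≤ 1 := fun u hu =>
      (Multiset.count_le_of_le u (Multiset.erase_le _ _)).trans (hcl u hu)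
    rcases hle.eq_or_lt with he | hlt
    · obtain ⟨mu, e, hmu⟩ := exists_hs (h := h) ((partsM lam).erase v)
        (fun hm => hz (Multiset.mem_of_mem_erase hm)) hcl'
      exact hno mu ⟨v, hmu, Or.inl ⟨he.symm, (mem_partsM _ _).2 hv, e⟩⟩
    · obtain ⟨mu, e, hmu⟩ := exists_hs (h := h) ((v - h) ::ₘ (partsM lam).erase v) (by
        simp only [Multiset.mem_cons, not_or]
        exact ⟨by omega, fun hm => hz (Multiset.mem_of_mem_erase hm)⟩) (by
        intro u hu
        rw [Multiset.count_cons, if_neg]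
        · exact hcl' u hu
        · rintro rfl
          exact hu (Nat.dvd_sub hd (dvd_refl h)))
      exact hno mu ⟨v, hmu, Or.inr (Or.inl ⟨hlt, (mem_partsM _ _).2 hv, e⟩)⟩
  refine ⟨?_, ?_, ?_, ?_⟩
  · intro r hr
    rcases hs r with h1 | h1 | h1
    · exact h1
    · exact (nd _ ⟨by omega, r, rfl⟩ h1.2).elim
    · omega
  · intro v hv h; exact nd v hv (Nat.dvd_of_mod_eq_zero h)
  · intro v hv hlt
    exact (step2 v hv hlt).resolve_left (nd v hv)
  · intro u v hu hv he
    have huv : v ≠ u := by omega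
    obtain ⟨mu, e, hmu⟩ := exists_hs (h := h) (((partsM lam).erase u).erase v)
        (fun hm => hz (Multiset.mem_of_mem_erase (Multiset.mem_of_mem_erase hm)))
        (fun w hw => (Multiset.count_le_of_le w
          ((Multiset.erase_le _ _).trans (Multiset.erase_le _ _))).trans (hcl w hw))
    refine hno mu ⟨max u v, hmu, Or.inr (Or.inr ⟨u, v, he, (mem_partsM _ _).2 hu, ?_, rfl, e⟩)⟩
    rw [Multiset.mem_erase_of_ne huv]
    exact (mem_partsM _ _).2 hv

theorem Core.hs {h : ℕ} {lam : BPartition} (H : Core h lam) : IsHStrict h lam := by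
  intro r
  rcases Nat.eq_zero_or_pos (lam.parts r) with h0 | h0
  · exact Or.inr (Or.inr h0)
  · exact Or.inl (H.strict r h0)

theorem Core.isBarCore {h : ℕ} (h1 : 0 < h) {lam : BPartition} (H : Core h lam) :
    IsBarCore h lam := by
  refine ⟨H.hs, ?_⟩
  rintro mu ⟨v, hmu, ⟨rfl, hv, -⟩ | ⟨hlt, hv, e⟩ | ⟨a, b, hab, ha, hb, -, -⟩⟩
  · rw [mem_partsM] at hv
    exact H.nd _ hv (Nat.mod_self _)
  · rw [mem_partsM] at hv
    have h2 := H.down v hv hlt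
    have h3 := count_le hmu (v := v - h) (fun hd => H.nd _ h2 (Nat.mod_eq_zero_of_dvd hd))
    rw [e, Multiset.count_cons_self, Multiset.count_erase_of_ne (by omega)] at h3
    have := Multiset.count_pos.2 ((mem_partsM _ _).2 h2)
    omega
  · exact H.sum a b ((mem_partsM _ _).1 ha)
      ((mem_partsM _ _).1 (Multiset.mem_of_mem_erase hb)) hab

theorem Core.c1 {h : ℕ} (h1 : 0 < h) {lam : BPartition} (H : Core h lam) (v : ℕ) :
    ∀ u, SS lam v → u ≠ 0 → u ≤ v → u % h = v % h → SS lam u := by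
  induction v using Nat.strong_induction_on with
  | _ v ih =>
    intro u hv hu huv he
    rcases huv.eq_or_lt with rfl | hlt
    · exact hv
    · have hmod : (v - u) % h = 0 := Nat.sub_mod_eq_zero_of_mod_eq he.symm
      have hle : h ≤ v - u := Nat.le_of_dvd (by omega) (Nat.dvd_of_mod_eq_zero hmod)
      refine ih (v - h) (by omega) u (H.down v hv (by omega)) hu (by omega) ?_
      rw [he, Nat.mod_eq_sub_mod (by omega)]

theorem Core.c2 {h : ℕ} (h1 : 0 < h) {lam : BPartition} (H : Core h lam) {u v : ℕ}
    (hu : SS lam u) (hv : SS lam v) : u % h + v % h ≠ h :=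
  H.sum _ _ (H.c1 h1 u _ hu (H.nd u hu) (Nat.mod_le _ _) (Nat.mod_mod _ _))
    (H.c1 h1 v _ hv (H.nd v hv) (Nat.mod_le _ _) (Nat.mod_mod _ _))

theorem ms {h : ℕ} (h1 : 0 < h) (m : ℕ) :
    (m % h + 1 = h ∧ (m + 1) % h = 0) ∨ (m % h + 1 < h ∧ (m + 1) % h = m % h + 1) := by
  have := Nat.mod_lt m h1
  rw [Nat.add_mod]
  rcases (show m % h + 1 ≤ h by omega).eq_or_lt with he | hlt
  · left
    refine ⟨he, ?_⟩
    rw [Nat.add_mod_mod, he, Nat.mod_self]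
  · right
    refine ⟨hlt, ?_⟩
    rw [Nat.add_mod_mod, Nat.mod_eq_of_lt hlt]

theorem cr {n h : ℕ} (hh : h = 2 * n + 1) (hn : 1 ≤ n) (c : ℕ) :
    (c % h = 0 ∧ colRes h c = 0) ∨
      (c % h ≠ 0 ∧ c % h < h ∧ colRes h c = min (c % h - 1) (h - c % h)) := by
  have hp : 0 < h := by omega
  have hlt := Nat.mod_lt c hp
  unfold colRes
  by_cases h0 : c % h = 0
  · left
    simp [h0]
  · right
    refine ⟨h0, hlt, ?_⟩
    have hc : c ≠ 0 := by rintro rfl; simp at h0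
    have := ms hp (c - 1)
    rw [show c - 1 + 1 = c by omega] at this
    rw [Nat.mod_eq_of_lt (show h - c % h < h by omega)]
    omega

theorem nonadj {n h i : ℕ} (hh : h = 2 * n + 1) (hn : 1 ≤ n) (hi1 : 1 ≤ i) {c : ℕ}
    (h1 : colRes h c = i) (h2 : colRes h (c + 1) = i) : False := by
  have hp : 0 < h := by omega
  have := cr hh hn c
  have := cr hh hn (c + 1)
  have := ms hp c
  omega

theorem add_unf {h i : ℕ} {σ : BPartition} {r c : ℕ} (H : Addable h i σ (r, c)) :
    colRes h c = i ∧ σ.parts r < c ∧ ∃ nu : BPartition, IsHStrict h nu ∧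
      (∀ q, σ.parts q ≤ nu.parts q) ∧ c ≤ nu.parts r ∧
      ∀ q d, σ.parts q < d → d ≤ nu.parts q → colRes h d = i := by
  obtain ⟨h1, h2, nu, h3, h4, h5, h6⟩ := H
  have h5' := h5.1
  rw [mem_diag] at h2
  simp only [] at h5' h1
  refine ⟨h1, by omega, nu, h3, diag_sub.1 h4, h5.2, fun q d hq hd => ?_⟩
  refine h6 (q, d) ⟨by simp only []; omega, hd⟩ ?_
  rw [mem_diag]
  omega

theorem rem_unf {h i : ℕ} {σ : BPartition} {r c : ℕ} (H : Removable h i σ (r, c)) :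
    1 ≤ c ∧ c ≤ σ.parts r ∧ ∃ mu : BPartition, IsHStrict h mu ∧
      (∀ q, mu.parts q ≤ σ.parts q) ∧ mu.parts r < c ∧
      ∀ q d, mu.parts q < d → d ≤ σ.parts q → colRes h d = i := by
  obtain ⟨h2, mu, h3, h4, h5, h6⟩ := H
  rw [mem_diag] at h5 h2
  refine ⟨h2.1, h2.2, mu, h3, diag_sub.1 h4, by omega, fun q d hq hd => ?_⟩
  refine h6 (q, d) ⟨by simp only []; omega, hd⟩ ?_
  rw [mem_diag]
  omega

theorem addU {n h i : ℕ} (hh : h = 2 * n + 1) (hn : 1 ≤ n) (hi1 : 1 ≤ i) {σ : BPartition}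
    {r c : ℕ} (H : Addable h i σ (r, c)) :
    c = σ.parts r + 1 ∧ colRes h c = i ∧ ¬ SS σ c := by
  obtain ⟨h1, h2, nu, h3, h4, h5, h6⟩ := add_unf H
  have hle : ∀ q, nu.parts q ≤ σ.parts q + 1 := by
    intro q
    by_contra hc
    exact nonadj hh hn hi1 (h6 q (σ.parts q + 1) (by omega) (by omega))
      (h6 q (σ.parts q + 1 + 1) (by omega) (by omega))
  have hr := hle r
  have hc : c = σ.parts r + 1 := by omega
  refine ⟨hc, h1, ?_⟩
  rintro ⟨-, q, hq⟩
  have hqr : q < r := by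
    by_contra hcon
    have := anti σ (show r ≤ q by omega)
    omega
  have e1 : nu.parts q = c := by
    by_contra hcon
    have h7 := hle q
    have h8 := h4 q
    exact nonadj hh hn hi1 h1 (h6 q (c + 1) (by omega) (by omega))
  have h7 := anti nu (show q + 1 ≤ r by omega)
  have h8 := cr hh hn c
  rcases h3 q with h9 | h9 | h9
  · omega
  · have := Nat.mod_eq_zero_of_dvd h9.2
    rw [e1] at this
    omega
  · omega

theorem remD {n h i : ℕ} (hh : h = 2 * n + 1) (hn : 1 ≤ n) (hi1 : 1 ≤ i) {σ : BPartition}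
    {r c : ℕ} (H : Removable h i σ (r, c)) :
    c = σ.parts r ∧ colRes h c = i ∧ ¬ SS σ (c - 1) := by
  obtain ⟨h1, h2, mu, h3, h4, h5, h6⟩ := rem_unf H
  have hle : ∀ q, σ.parts q ≤ mu.parts q + 1 := by
    intro q
    by_contra hc
    exact nonadj hh hn hi1 (h6 q (mu.parts q + 1) (by omega) (by omega))
      (h6 q (mu.parts q + 1 + 1) (by omega) (by omega))
  have hr := hle r
  have hc : c = σ.parts r := by omega
  have hci : colRes h c = i := h6 r c h5 h2
  refine ⟨hc, hci, ?_⟩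
  rintro ⟨h0, q, hq⟩
  have hqr : r < q := by
    by_contra hcon
    have := anti σ (show q ≤ r by omega)
    omega
  have e1 : mu.parts q = c - 1 := by
    by_contra hcon
    have h7 := hle q
    have h8 := h4 q
    have h9 := h6 q (c - 1) (by omega) (by omega)
    exact nonadj hh hn hi1 h9 (by rwa [show c - 1 + 1 = c by omega])
  have h7 := anti mu (show r + 1 ≤ q by omega)
  have h8 := cr hh hn c
  have h10 := ms (show 0 < h by omega) (c - 1)
  rw [show c - 1 + 1 = c by omega] at h10
  rcases h3 r with h9 | h9 | h9
  · omega
  · have := Nat.mod_eq_zero_of_dvd h9.2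
    rw [show mu.parts r = c - 1 by omega] at this
    omega
  · omega

theorem nb {n h i : ℕ} (hh : h = 2 * n + 1) (hn : 1 ≤ n) (hi1 : 1 ≤ i) (hi : i ≤ n)
    {σ : BPartition} (H : Core h σ) {m k : ℕ} (hm : SS σ m) (hU : colRes h (m + 1) = i)
    (hm' : ¬ SS σ (m + 1)) (hk : SS σ (k + 1)) (hD : colRes h (k + 1) = i)
    (hk' : ¬ SS σ k) : False := by
  have hp : 0 < h := by omega
  have a1 := cr hh hn (m + 1)
  have a2 := ms hp m
  have a3 := cr hh hn (k + 1)
  have a4 := ms hp k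
  have hk0 : k ≠ 0 := by
    rintro rfl
    simp only [Nat.zero_mod] at a4
    omega
  by_cases he : m % h = k % h
  · rcases le_or_gt k m with hle | hgt
    · exact hk' (H.c1 hp m k hm hk0 hle he.symm)
    · exact hm' (H.c1 hp (k + 1) (m + 1) hk (by omega) (by omega) (by omega))
  · exact H.c2 hp hm hk (by omega)

theorem mk_add {h i : ℕ} {σ τ : BPartition} (hs : IsHStrict h τ)
    (hle : ∀ q, σ.parts q ≤ τ.parts q)
    (hres : ∀ q d, σ.parts q < d → d ≤ τ.parts q → colRes h d = i) (x : ℕ × ℕ)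
    (hx : x ∈ diagram τ ∧ x ∉ diagram σ) : Addable h i σ x := by
  have key : ∀ y ∈ diagram τ, y ∉ diagram σ → colRes h y.2 = i := by
    rintro ⟨q, d⟩ h1 h2
    rw [mem_diag] at h1 h2
    exact hres q d (by omega) h1.2
  exact ⟨key x hx.1 hx.2, hx.2, τ, hs, diag_sub.2 hle, hx.1, key⟩

theorem mk_rem {h i : ℕ} {σ τ : BPartition} (hs : IsHStrict h τ)
    (hle : ∀ q, τ.parts q ≤ σ.parts q)
    (hres : ∀ q d, τ.parts q < d → d ≤ σ.parts q → colRes h d = i) (x : ℕ × ℕ)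
    (hx : x ∈ diagram σ ∧ x ∉ diagram τ) : Removable h i σ x := by
  refine ⟨hx.1, τ, hs, diag_sub.2 hle, hx.2, ?_⟩
  rintro ⟨q, d⟩ h1 h2
  rw [mem_diag] at h1 h2
  exact hres q d (by omega) h1.2

def sw (h i v : ℕ) : ℕ :=
  if colRes h (v + 1) = i then v + 1 else if colRes h v = i then v - 1 else v

theorem sw_cases {n h i : ℕ} (hh : h = 2 * n + 1) (hn : 1 ≤ n) (hi1 : 1 ≤ i) (hi : i ≤ n)
    (v : ℕ) : (sw h i v = v + 1 ∧ (v % h = i ∨ v % h + i + 1 = h)) ∨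
      (sw h i v + 1 = v ∧ (v % h = i + 1 ∨ v % h + i = h) ∧ 2 ≤ v) ∨
      (sw h i v = v ∧ v % h ≠ i ∧ v % h + i + 1 ≠ h ∧ v % h ≠ i + 1 ∧ v % h + i ≠ h) := by
  have hp : 0 < h := by omega
  have a1 := cr hh hn (v + 1)
  have a2 := ms hp v
  have a3 := cr hh hn v
  have a4 : v % h ≤ v := Nat.mod_le _ _
  unfold sw
  split_ifs with h1 h2
  · left; omega
  · right; left; omega
  · right; right; omega

theorem sw_sw {n h i : ℕ} (hh : h = 2 * n + 1) (hn : 1 ≤ n) (hi1 : 1 ≤ i) (hi : i ≤ n)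
    (v : ℕ) : sw h i (sw h i v) = v := by
  have hp : 0 < h := by omega
  have b1 := sw_cases hh hn hi1 hi v
  have b2 := sw_cases hh hn hi1 hi (sw h i v)
  have a2 := ms hp v
  have a3 := ms hp (sw h i v)
  rcases b1 with b1 | b1 | b1
  · rw [b1.1] at b2 a3 ⊢
    omega
  · rw [b1.1] at a3
    omega
  · rw [b1.1, b1.1]

open Classical in
noncomputable def gg (h i : ℕ) (σ : BPartition) (m : ℕ) : ℕ :=
  if SS σ (sw h i m) then m else sw h i m

/-- the core obtained by swapping, for positive residue -/
theorem exists_swap {n h i : ℕ} (hh : h = 2 * n + 1) (hn : 1 ≤ n) (hi1 : 1 ≤ i) (hi : i ≤ n)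
    {σ : BPartition} (H : Core h σ) :
    ∃ τ : BPartition, Core h τ ∧ ∀ r, τ.parts r = gg h i σ (σ.parts r) := by
  have hp : 0 < h := by omega
  have sc := sw_cases hh hn hi1 hi
  have sw0 : sw h i 0 = 0 := by
    have := sc 0
    simp only [Nat.zero_mod] at this
    omega
  have swne : ∀ v, v ≠ 0 → sw h i v ≠ 0 := by
    intro v hv
    have := sc v
    omega
  have g0 : gg h i σ 0 = 0 := by unfold gg; rw [sw0]; simp
  have gne : ∀ m, m ≠ 0 → gg h i σ m ≠ 0 := by
    intro m hm; unfold gg; split_ifs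
    · exact hm
    · exact swne m hm
  have hstr : ∀ r, 0 < σ.parts r → gg h i σ (σ.parts (r + 1)) < gg h i σ (σ.parts r) := by
    intro r hr
    have hlt := H.strict r hr
    rcases Nat.eq_zero_or_pos (σ.parts (r + 1)) with h0 | h0
    · rw [h0, g0]
      have := gne (σ.parts r) (by omega)
      omega
    · have s1 : SS σ (σ.parts r) := ⟨by omega, r, rfl⟩
      have s2 : SS σ (σ.parts (r + 1)) := ⟨by omega, r + 1, rfl⟩
      generalize σ.parts r = a at *
      generalize σ.parts (r + 1) = b at *
      have c1 := sc a
      have c2 := sc b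
      have d1 := ms hp b
      have d2 := ms hp (b + 1)
      unfold gg
      split_ifs with e1 e2 e2
      · omega
      · have : sw h i a ≠ b := fun hcon => e2 (by rw [hcon]; exact s2)
        omega
      · have : sw h i b ≠ a := fun hcon => e1 (by rw [hcon]; exact s1)
        omega
      · have h3 : sw h i a ≠ b := fun hcon => e2 (by rw [hcon]; exact s2)
        have h4 : sw h i b ≠ a := fun hcon => e1 (by rw [hcon]; exact s1)
        by_cases h5 : a = b + 1 + 1
        · subst h5
          omega
        · omega
  obtain ⟨N, hN⟩ := ev_zero σ
  obtain ⟨τ, hτ⟩ := exists_mk (fun r => gg h i σ (σ.parts r)) (by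
    intro r
    rcases Nat.eq_zero_or_pos (σ.parts r) with h0 | h0
    · have := σ.antitone r
      rw [show σ.parts (r + 1) = 0 by omega, g0]
      omega
    · exact (hstr r h0).le) N (by
    intro r hr
    simp only [hN r hr, g0])
  have hS : ∀ v, SS τ v ↔ SS σ (sw h i v) := by
    intro v
    constructor
    · rintro ⟨hv, r, hr⟩
      rw [hτ] at hr
      have hr0 : σ.parts r ≠ 0 := by
        intro h0; simp only [h0, g0] at hr; exact hv hr.symm
      have s1 : SS σ (σ.parts r) := ⟨hr0, r, rfl⟩
      unfold gg at hr
      split_ifs at hr with e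
      · rwa [← hr]
      · rw [← hr, sw_sw hh hn hi1 hi]; exact s1
    · intro hs
      have hv : v ≠ 0 := by
        rintro rfl; rw [sw0] at hs; exact hs.1 rfl
      refine ⟨hv, ?_⟩
      by_cases hv' : SS σ v
      · obtain ⟨-, r, hr⟩ := hv'
        refine ⟨r, ?_⟩
        rw [hτ]
        simp only [hr]
        unfold gg
        rw [if_pos hs]
      · obtain ⟨-, r, hr⟩ := hs
        refine ⟨r, ?_⟩
        rw [hτ]
        simp only [hr]
        unfold gg
        rw [sw_sw hh hn hi1 hi, if_neg hv']
  refine ⟨τ, ⟨?_, ?_, ?_, ?_⟩, hτ⟩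
  · intro r hr
    rw [hτ] at hr ⊢
    rw [hτ]
    apply hstr
    by_contra hc
    rw [show σ.parts r = 0 by omega, g0] at hr
    omega
  · intro v hv h0
    rw [hS] at hv
    have := sc v
    have h2 := H.nd _ hv
    have h3 : sw h i v = v := by omega
    rw [h3] at h2
    exact h2 h0
  · intro v hv hlt
    rw [hS] at hv ⊢
    have e : v % h = (v - h) % h := Nat.mod_eq_sub_mod hlt.le
    have c1 := sc v
    have c2 := sc (v - h)
    have h2 := H.nd _ hv
    have h3 : sw h i v ≠ h := by
      intro hc; rw [hc, Nat.mod_self] at h2; exact h2 rfl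
    have h4 := H.down _ hv (by omega)
    rwa [show sw h i (v - h) = sw h i v - h by omega]
  · intro u v hu hv he
    have hu0 := hu.1
    have hv0 := hv.1
    rw [hS] at hu hv
    have c1 := sc u
    have c2 := sc v
    rw [Nat.mod_eq_of_lt (show u < h by omega)] at c1
    rw [Nat.mod_eq_of_lt (show v < h by omega)] at c2
    exact H.sum _ _ hu hv (by omega)

theorem pos_case {n h i : ℕ} (hh : h = 2 * n + 1) (hn : 1 ≤ n) (hi1 : 1 ≤ i) (hi : i ≤ n)
    {σ : BPartition} (H : Core h σ) :
    (¬ ((∃ x, Addable h i σ x) ∧ (∃ x, Removable h i σ x))) ∧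
    ∃ τ, Core h τ ∧ psi h i σ = τ ∧ (∀ τ' : BPartition, Core h τ' → diagram σ ⊂ diagram τ' →
      (∀ x ∈ diagram τ' \ diagram σ, colRes h x.2 = i) → τ' = τ) := by
  have hp : 0 < h := by omega
  have hz : colRes h 1 ≠ i := by
    have := cr hh hn 1
    have e : 1 % h = 1 := Nat.mod_eq_of_lt (by omega)
    rw [e] at this
    omega
  -- up moves and down moves
  have hup : ∀ r c, Addable h i σ (r, c) → SS σ (σ.parts r) ∧
      colRes h (σ.parts r + 1) = i ∧ ¬ SS σ (σ.parts r + 1) ∧ c = σ.parts r + 1 := by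
    intro r c hx
    obtain ⟨e, h1, h2⟩ := addU hh hn hi1 hx
    subst e
    refine ⟨⟨?_, r, rfl⟩, h1, h2, rfl⟩
    intro h0
    rw [h0] at h1
    exact hz h1
  have hdn : ∀ r c, Removable h i σ (r, c) → ∃ k, c = k + 1 ∧ σ.parts r = k + 1 ∧
      colRes h (k + 1) = i ∧ ¬ SS σ k := by
    intro r c hx
    obtain ⟨e, h1, h2⟩ := remD hh hn hi1 hx
    have := (rem_unf hx).1
    refine ⟨c - 1, by omega, by omega, ?_, h2⟩
    rwa [show c - 1 + 1 = c by omega]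
  obtain ⟨τ, hτ, hg⟩ := exists_swap hh hn hi1 hi H
  have hgg : ∀ m, (gg h i σ m = m + 1 ∧ colRes h (m + 1) = i ∧ ¬ SS σ (m + 1)) ∨
      (gg h i σ m + 1 = m ∧ colRes h m = i ∧ ¬ SS σ (m - 1)) ∨
      (gg h i σ m = m ∧ (colRes h (m + 1) = i → SS σ (m + 1))
        ∧ (colRes h (m + 1) ≠ i → colRes h m = i → SS σ (m - 1))) := by
    intro m
    have h1 := cr hh hn m
    have h2 : m = 0 → colRes h m ≠ i := by
      rintro rfl
      rw [Nat.zero_mod] at h1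
      omega
    by_cases a1 : colRes h (m + 1) = i
    · have e : sw h i m = m + 1 := by unfold sw; rw [if_pos a1]
      unfold gg
      rw [e]
      by_cases a2 : SS σ (m + 1)
      · rw [if_pos a2]
        exact Or.inr (Or.inr ⟨rfl, fun _ => a2, fun hc => (hc a1).elim⟩)
      · rw [if_neg a2]
        exact Or.inl ⟨rfl, a1, a2⟩
    · by_cases a3 : colRes h m = i
      · have e : sw h i m = m - 1 := by unfold sw; rw [if_neg a1, if_pos a3]
        unfold gg
        rw [e]
        by_cases a2 : SS σ (m - 1)
        · rw [if_pos a2]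
          exact Or.inr (Or.inr ⟨rfl, fun hc => (a1 hc).elim, fun _ _ => a2⟩)
        · rw [if_neg a2]
          exact Or.inr (Or.inl ⟨by omega, a3, a2⟩)
      · have e : sw h i m = m := by unfold sw; rw [if_neg a1, if_neg a3]
        unfold gg
        rw [e, ite_self]
        exact Or.inr (Or.inr ⟨rfl, fun hc => (a1 hc).elim, fun _ hc => (a3 hc).elim⟩)
  refine ⟨?_, τ, hτ, ?_, ?_⟩
  · rintro ⟨⟨⟨r, c⟩, h1⟩, ⟨⟨r', c'⟩, h2⟩⟩
    obtain ⟨a1, a2, a3, -⟩ := hup r c h1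
    obtain ⟨k, -, b1, b2, b3⟩ := hdn r' c' h2
    exact nb hh hn hi1 hi H a1 a2 a3 ⟨by omega, r', b1⟩ b2 b3
  · by_cases hcase : ∃ k, SS σ (k + 1) ∧ colRes h (k + 1) = i ∧ ¬ SS σ k
    · obtain ⟨k, b1, b2, b3⟩ := hcase
      have hno : ∀ r, ¬ (gg h i σ (σ.parts r) = σ.parts r + 1 ∧
          colRes h (σ.parts r + 1) = i ∧ ¬ SS σ (σ.parts r + 1)) := by
        rintro r ⟨-, a2, a3⟩
        refine nb hh hn hi1 hi H ⟨?_, r, rfl⟩ a2 a3 b1 b2 b3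
        intro h0
        rw [h0] at a2
        exact hz a2
      have hle : ∀ q, τ.parts q ≤ σ.parts q := by
        intro q
        rw [hg]
        have := (hgg (σ.parts q)).resolve_left (hno q)
        omega
      have hres : ∀ q d, τ.parts q < d → d ≤ σ.parts q → colRes h d = i := by
        intro q d h1 h2
        rw [hg] at h1
        rcases (hgg (σ.parts q)).resolve_left (hno q) with h3 | h3
        · rw [show d = σ.parts q by omega]; exact h3.2.1
        · omega
      refine psi_down ?_ ?_ (diag_sub.2 hle)
      · rintro ⟨r, c⟩ hx
        obtain ⟨a1, a2, a3, -⟩ := hup r c hx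
        exact nb hh hn hi1 hi H a1 a2 a3 b1 b2 b3
      · intro x
        refine ⟨?_, mk_rem hτ.hs hle hres x⟩
        intro hx
        obtain ⟨r, c⟩ := x
        refine ⟨hx.1, ?_⟩
        obtain ⟨k, c1, c2, c3, c4⟩ := hdn r c hx
        rw [mem_diag, hg, c2]
        have hup' := hno r
        rw [c2] at hup'
        rcases (hgg (k + 1)).resolve_left hup' with h3 | h3
        · omega
        · exfalso
          exact c4 (h3.2.2 (fun hc => nonadj hh hn hi1 c3 hc) c3)
    · have hno : ∀ r, ¬ (gg h i σ (σ.parts r) + 1 = σ.parts r ∧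
          colRes h (σ.parts r) = i ∧ ¬ SS σ (σ.parts r - 1)) := by
        rintro r ⟨a1, a2, a3⟩
        refine hcase ⟨σ.parts r - 1, ?_⟩
        rw [show σ.parts r - 1 + 1 = σ.parts r by omega]
        exact ⟨⟨by omega, r, rfl⟩, a2, a3⟩
      have hg2 : ∀ q, _ ∨ _ := fun q => (or_left_comm.1 (hgg (σ.parts q))).resolve_left (hno q)
      have hle : ∀ q, σ.parts q ≤ τ.parts q := by
        intro q
        rw [hg]
        have := hg2 q
        omega
      have hres : ∀ q d, σ.parts q < d → d ≤ τ.parts q → colRes h d = i := by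
        intro q d h1 h2
        rw [hg] at h2
        rcases hg2 q with h3 | h3
        · rw [show d = σ.parts q + 1 by omega]; exact h3.2.1
        · omega
      refine psi_up ?_ ?_ (diag_sub.2 hle)
      · rintro ⟨r, c⟩ hx
        obtain ⟨k, c1, c2, c3, c4⟩ := hdn r c hx
        exact hcase ⟨k, ⟨by omega, r, c2⟩, c3, c4⟩
      · intro x
        refine ⟨?_, mk_add hτ.hs hle hres x⟩
        intro hx
        obtain ⟨r, c⟩ := x
        refine ⟨?_, hx.2.1⟩
        obtain ⟨a1, a2, a3, a4⟩ := hup r c hx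
        rw [mem_diag, hg]
        rcases hg2 r with h3 | h3
        · omega
        · exact (a3 (h3.2.1 a2)).elim
  · intro τ' H' hsub hres
    have hle := diag_sub.1 hsub.1
    have hadd : ∀ r c, σ.parts r < c → c ≤ τ'.parts r → Addable h i σ (r, c) := by
      intro r c h1 h2
      refine mk_add H'.hs hle ?_ (r, c) ?_
      · intro q d h3 h4
        refine hres (q, d) ⟨⟨by simp only []; omega, h4⟩, ?_⟩
        rw [mem_diag]; omega
      · rw [mem_diag, mem_diag]; omega
    have hmv : ∀ r, τ'.parts r = σ.parts r ∨ (τ'.parts r = σ.parts r + 1 ∧ SS σ (σ.parts r) ∧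
        colRes h (σ.parts r + 1) = i ∧ ¬ SS σ (σ.parts r + 1)) := by
      intro r
      rcases (hle r).eq_or_lt with h1 | h1
      · exact Or.inl h1.symm
      · right
        obtain ⟨a1, a2, a3, a4⟩ := hup r _ (hadd r (τ'.parts r) h1 (le_refl _))
        exact ⟨a4, a1, a2, a3⟩
    have hinj : ∀ q r, σ.parts q = σ.parts r → σ.parts q ≠ 0 → q = r := by
      intro q r h1 h2
      rcases lt_trichotomy q r with h3 | h3 | h3
      · have := H.strict q (by omega)
        have := anti σ (show q + 1 ≤ r by omega)
        omega
      · exact h3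
      · have := H.strict r (by omega)
        have := anti σ (show r + 1 ≤ q by omega)
        omega
    obtain ⟨r0, hr0⟩ : ∃ r, τ'.parts r ≠ σ.parts r := by
      by_contra hc
      push Not at hc
      exact hsub.2 (diag_sub.2 fun r => (hc r).le)
    obtain ⟨m1, m2, m3, m4⟩ := (hmv r0).resolve_left hr0
    refine bp_ext fun r => ?_
    rw [hg]
    rcases hmv r with h1 | ⟨h1, h2, h3, h4⟩
    · rw [h1]
      rcases hgg (σ.parts r) with h5 | h5 | h5
      · exfalso
        obtain ⟨-, h6, h7⟩ := h5
        have hb0 : σ.parts r ≠ 0 := by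
          intro h0; rw [h0] at h6; exact hz h6
        have p1 : SS τ' (σ.parts r) := ⟨hb0, r, h1⟩
        have p2 : ¬ SS τ' (σ.parts r + 1) := by
          rintro ⟨-, q, hq⟩
          rcases hmv q with h8 | ⟨h8, -⟩
          · exact h7 ⟨by omega, q, by omega⟩
          · have := hinj q r (by omega) (by omega)
            subst this
            omega
        have p3 : SS τ' (σ.parts r0 + 1) := ⟨by omega, r0, m1⟩
        have p4 : ¬ SS τ' (σ.parts r0) := by
          rintro ⟨h9, q, hq⟩
          rcases hmv q with h8 | ⟨h8, -, h10, -⟩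
          · have := hinj q r0 (by omega) (by omega)
            subst this
            omega
          · rw [← h8, hq] at h10
            exact nonadj hh hn hi1 h10 m3
        have a1 := cr hh hn (σ.parts r + 1)
        have a2 := ms hp (σ.parts r)
        have a3 := cr hh hn (σ.parts r0 + 1)
        have a4 := ms hp (σ.parts r0)
        by_cases he : σ.parts r % h = σ.parts r0 % h
        · rcases le_or_gt (σ.parts r0) (σ.parts r) with hl | hl
          · exact p4 (H'.c1 hp _ _ p1 m2.1 hl he.symm)
          · exact p2 (H'.c1 hp _ _ p3 (by omega) (by omega) (by omega))
        · exact H'.c2 hp p3 p1 (by omega)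
      · exfalso
        obtain ⟨h6, h7, h8⟩ := h5
        have e : σ.parts r - 1 + 1 = σ.parts r := by omega
        exact nb hh hn hi1 hi H m2 m3 m4 (k := σ.parts r - 1)
          (by rw [e]; exact ⟨by omega, r, rfl⟩) (by rw [e]; exact h7) h8
      · exact h5.1.symm
    · rw [h1]
      rcases hgg (σ.parts r) with h5 | h5 | h5
      · exact h5.1.symm
      · exact (nonadj hh hn hi1 h5.2.1 h3).elim
      · exact (h4 (h5.2.1 h3)).elim

theorem cr0 {n h : ℕ} (hh : h = 2 * n + 1) (hn : 1 ≤ n) (c : ℕ) :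
    colRes h c = 0 ↔ c % h = 0 ∨ c % h = 1 := by
  have := cr hh hn c
  omega

theorem addZ {n h : ℕ} (hh : h = 2 * n + 1) (hn : 1 ≤ n) {σ : BPartition} (H : Core h σ)
    {r c : ℕ} (hx : Addable h 0 σ (r, c)) :
    ¬ SS σ 1 ∧ σ.parts r < c ∧ ((σ.parts r % h + 1 = h ∧ c ≤ σ.parts r + 2) ∨
      (σ.parts r = 0 ∧ c = 1 ∧ ∀ q, q < r → σ.parts q ≠ 0)) := by
  have hp : 0 < h := by omega
  have e1 : 1 % h = 1 := Nat.mod_eq_of_lt (by omega)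
  have e2 : 2 % h = 2 := Nat.mod_eq_of_lt (by omega)
  obtain ⟨h1, h2, nu, h3, h4, h5, h6⟩ := add_unf hx
  have a1 := (cr0 hh hn _).1 (h6 r (σ.parts r + 1) (by omega) (by omega))
  have a2 := ms hp (σ.parts r)
  by_cases h0 : σ.parts r = 0
  · have hle : ∀ q, σ.parts q ≤ 1 → nu.parts q ≤ 1 := by
      intro q hq
      by_contra hc
      have := (cr0 hh hn _).1 (h6 q 2 (by omega) (by omega))
      omega
    have key : ∀ q, q < r → ¬ σ.parts q ≤ 1 := by
      intro q hq hc
      have b1 := hle q hc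
      have b2 := anti nu (show q + 1 ≤ r by omega)
      have b3 := nu.antitone q
      rcases h3 q with h9 | h9 | h9
      · omega
      · have := Nat.le_of_dvd h9.1 h9.2
        omega
      · omega
    refine ⟨?_, h2, Or.inr ⟨h0, ?_, fun q hq hc => key q hq (by omega)⟩⟩
    · rintro ⟨-, q, hq⟩
      refine key q ?_ (by omega)
      by_contra hc
      have := anti σ (show r ≤ q by omega)
      omega
    · have := hle r (by omega)
      omega
  · have s1 : SS σ (σ.parts r) := ⟨h0, r, rfl⟩
    have hnd := H.nd _ s1
    have hm : σ.parts r % h + 1 = h := by omega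
    refine ⟨?_, h2, Or.inl ⟨hm, ?_⟩⟩
    · intro hs
      apply H.c2 hp s1 hs
      omega
    · by_contra hc
      have b1 := (cr0 hh hn _).1 (h6 r (σ.parts r + 1 + 1 + 1) (by omega) (by omega))
      have b2 := ms hp (σ.parts r + 1)
      have b3 := ms hp (σ.parts r + 1 + 1)
      omega

theorem remZ {n h : ℕ} (hh : h = 2 * n + 1) (hn : 1 ≤ n) {σ : BPartition} (H : Core h σ)
    {r c : ℕ} (hx : Removable h 0 σ (r, c)) :
    SS σ 1 ∧ σ.parts r % h = 1 ∧ σ.parts r - 2 < c := by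
  have hp : 0 < h := by omega
  have e1 : 1 % h = 1 := Nat.mod_eq_of_lt (by omega)
  obtain ⟨h1, h2, mu, h3, h4, h5, h6⟩ := rem_unf hx
  have a1 := (cr0 hh hn _).1 (h6 r (σ.parts r) (by omega) (by omega))
  have s1 : SS σ (σ.parts r) := ⟨by omega, r, rfl⟩
  have hnd := H.nd _ s1
  have hm : σ.parts r % h = 1 := by omega
  refine ⟨H.c1 hp _ _ s1 (by omega) (by omega) (by omega), hm, ?_⟩
  by_contra hc
  have b1 := (cr0 hh hn _).1 (h6 r (σ.parts r - 2) (by omega) (by omega))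
  have b2 := ms hp (σ.parts r - 2)
  have b3 := ms hp (σ.parts r - 2 + 1)
  rw [show σ.parts r - 2 + 1 + 1 = σ.parts r by omega] at b3
  omega

theorem zero_down {n h : ℕ} (hh : h = 2 * n + 1) (hn : 1 ≤ n) {σ : BPartition} (H : Core h σ)
    (h1 : SS σ 1) : Core h (psi h 0 σ) := by
  have hp : 0 < h := by omega
  have e1 : 1 % h = 1 := Nat.mod_eq_of_lt (by omega)
  have hn1 : ∀ v, SS σ v → v % h + 1 ≠ h := by
    intro v hv hc
    apply H.c2 hp hv h1
    omega
  have m2 : ∀ v, 2 ≤ v → v % h = 1 → (v - 1) % h = 0 ∧ (v - 2) % h + 1 = h := by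
    intro v hv hm
    have b2 := ms hp (v - 2)
    have b3 := ms hp (v - 2 + 1)
    rw [show v - 2 + 1 + 1 = v by omega] at b3
    rw [show v - 2 + 1 = v - 1 by omega] at b2 b3
    omega
  have hstr : ∀ r, σ.parts r ≠ 0 → σ.parts (r + 1) < σ.parts r ∧
      (σ.parts r % h = 1 → σ.parts r ≠ 1 → σ.parts (r + 1) < σ.parts r - 2) := by
    intro r hr
    have hlt := H.strict r (by omega)
    refine ⟨hlt, fun hm hne => ?_⟩
    obtain ⟨c1, c2⟩ := m2 (σ.parts r) (by omega) hm
    have hle : h ≤ σ.parts r := by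
      by_contra hc
      rw [Nat.mod_eq_of_lt (by omega)] at hm
      omega
    rcases Nat.eq_zero_or_pos (σ.parts (r + 1)) with h0 | h0
    · omega
    · have s1 : SS σ (σ.parts (r + 1)) := ⟨by omega, r + 1, rfl⟩
      have d1 := H.nd _ s1
      have d2 := hn1 _ s1
      have d3 : σ.parts (r + 1) ≠ σ.parts r - 1 := fun hc => d1 (hc ▸ c1)
      have d4 : σ.parts (r + 1) ≠ σ.parts r - 2 := fun hc => d2 (hc ▸ c2)
      omega
  obtain ⟨N, hN⟩ := ev_zero σ
  obtain ⟨τ, hτ⟩ := exists_mk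
    (fun r => if σ.parts r % h = 1 then σ.parts r - 2 else σ.parts r) (by
    intro r
    have ha := σ.antitone r
    by_cases h0 : σ.parts r = 0
    · rw [show σ.parts (r + 1) = 0 by omega, h0]
    · have := hstr r h0
      split_ifs <;> omega) N (by
    intro r hr
    simp [hN r hr])
  have hS : ∀ v, SS τ v ↔ v ≠ 0 ∧ ((v % h + 1 = h ∧ SS σ (v + 2)) ∨
      (v % h ≠ 1 ∧ SS σ v)) := by
    intro v
    have b1 := ms hp v
    have b2 := ms hp (v + 1)
    constructor
    · rintro ⟨hv, r, hr⟩
      refine ⟨hv, ?_⟩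
      rw [hτ] at hr
      split_ifs at hr with hm
      · have e : σ.parts r = v + 1 + 1 := by omega
        rw [e] at hm
        exact Or.inl ⟨by omega, by omega, r, e⟩
      · rw [hr] at hm
        exact Or.inr ⟨hm, hv, r, hr⟩
    · rintro ⟨hv, ⟨hm, -, r, hr⟩ | ⟨hm, -, r, hr⟩⟩
      · refine ⟨hv, r, ?_⟩
        rw [hτ]
        simp only [hr]
        rw [if_pos (by rw [show v + 2 = v + 1 + 1 by rfl]; omega)]
        omega
      · refine ⟨hv, r, ?_⟩
        rw [hτ]
        simp only [hr]
        rw [if_neg hm]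
  have hcore : Core h τ := by
    refine ⟨?_, ?_, ?_, ?_⟩
    · intro r hr
      rw [hτ] at hr ⊢
      rw [hτ]
      have h0 : σ.parts r ≠ 0 := by
        intro h0; rw [h0] at hr; simp at hr
      have := hstr r h0
      split_ifs at hr ⊢ <;> omega
    · intro v hv
      obtain ⟨h0, h2 | h2⟩ := (hS v).1 hv
      · omega
      · exact H.nd v h2.2
    · intro v hv hlt
      have e : v % h = (v - h) % h := Nat.mod_eq_sub_mod hlt.le
      obtain ⟨h0, h2 | h2⟩ := (hS v).1 hv
      · rw [hS]
        have := H.down _ h2.2 (by omega)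
        rw [show v + 2 - h = v - h + 2 by omega] at this
        exact ⟨by omega, Or.inl ⟨by omega, this⟩⟩
      · rw [hS]
        exact ⟨by omega, Or.inr ⟨by omega, H.down _ h2.2 hlt⟩⟩
    · have key : ∀ u v, u ≠ 0 → v ≠ 0 → u + v = h → u % h + 1 = h → v % h = 1 := by
        intro u v hu hv he hm
        rw [Nat.mod_eq_of_lt (by omega)] at hm ⊢
        omega
      intro u v hu hv he
      obtain ⟨u0, hu⟩ := (hS u).1 hu
      obtain ⟨v0, hv⟩ := (hS v).1 hv
      have k1 := key u v u0 v0 he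
      have k2 := key v u v0 u0 (by omega)
      have k3 : h ≠ 2 := by omega
      rcases hu with hu | hu
      · rcases hv with hv | hv
        · omega
        · exact hv.1 (k1 hu.1)
      · rcases hv with hv | hv
        · exact hu.1 (k2 hv.1)
        · exact H.sum u v hu.2 hv.2 he
  have hle : ∀ q, τ.parts q ≤ σ.parts q := by
    intro q
    rw [hτ]
    split_ifs <;> omega
  have hpsi : psi h 0 σ = τ := by
    refine psi_down ?_ ?_ (diag_sub.2 hle)
    · rintro ⟨r, c⟩ hx
      exact (addZ hh hn H hx).1 h1
    · intro x
      refine ⟨?_, mk_rem hcore.hs hle ?_ x⟩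
      · intro hx
        obtain ⟨r, c⟩ := x
        refine ⟨hx.1, ?_⟩
        obtain ⟨-, a1, a2⟩ := remZ hh hn H hx
        rw [mem_diag, hτ]
        simp only [a1, if_true]
        omega
      · intro q d d1 d2
        rw [cr0 hh hn]
        rw [hτ] at d1
        split_ifs at d1 with hm
        · by_cases hd : d = σ.parts q
          · rw [hd]; exact Or.inr hm
          · have : d = σ.parts q - 1 := by omega
            rw [this]
            exact Or.inl (m2 _ (by omega) hm).1
        · omega
  rw [hpsi]
  exact hcore

theorem zero_up {n h : ℕ} (hh : h = 2 * n + 1) (hn : 1 ≤ n) {σ : BPartition} (H : Core h σ)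
    (h1 : ¬ SS σ 1) : Core h (psi h 0 σ) ∧
    (∀ τ' : BPartition, Core h τ' → diagram σ ⊂ diagram τ' →
      (∀ x ∈ diagram τ' \ diagram σ, colRes h x.2 = 0) → τ' = psi h 0 σ) := by
  have hp : 0 < h := by omega
  have e1 : 1 % h = 1 := Nat.mod_eq_of_lt (by omega)
  have hn1 : ∀ v, SS σ v → v % h ≠ 1 := by
    intro v hv hc
    exact h1 (H.c1 hp v 1 hv (by omega) (by have := hv.1; omega) (by omega))
  have m2 : ∀ v, v % h + 1 = h → (v + 1) % h = 0 ∧ (v + 2) % h = 1 := by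
    intro v hv
    have b2 := ms hp v
    have b3 := ms hp (v + 1)
    rw [show v + 1 + 1 = v + 2 by omega] at b3
    omega
  obtain ⟨N, hN⟩ := ev_zero σ
  have hex : ∃ L, σ.parts L = 0 := ⟨N, hN N (le_refl _)⟩
  obtain ⟨L, hL, hLmin⟩ : ∃ L, σ.parts L = 0 ∧ ∀ q, q < L → σ.parts q ≠ 0 := by
    classical
    exact ⟨Nat.find hex, Nat.find_spec hex, fun q hq => Nat.find_min hex hq⟩
  have hLz : ∀ q, L ≤ q → σ.parts q = 0 := by
    intro q hq
    have := anti σ hq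
    omega
  have hz : ¬ (0 % h + 1 = h) := by rw [Nat.zero_mod]; omega
  have hstr : ∀ r, σ.parts r ≠ 0 → σ.parts (r + 1) < σ.parts r ∧ 1 < σ.parts r ∧
      (σ.parts (r + 1) % h + 1 = h → σ.parts (r + 1) + 2 < σ.parts r) := by
    intro r hr
    have hlt := H.strict r (by omega)
    have s1 : SS σ (σ.parts r) := ⟨by omega, r, rfl⟩
    have d1 := H.nd _ s1
    have d2 := hn1 _ s1
    refine ⟨hlt, ?_, fun hm => ?_⟩
    · by_contra hc
      exact h1 ⟨by omega, r, by omega⟩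
    · obtain ⟨c1, c2⟩ := m2 _ hm
      have d3 : σ.parts r ≠ σ.parts (r + 1) + 1 := fun hc => d1 (by rw [hc]; exact c1)
      have d4 : σ.parts r ≠ σ.parts (r + 1) + 2 := fun hc => d2 (by rw [hc]; exact c2)
      omega
  let f : ℕ → ℕ := fun r => if σ.parts r % h + 1 = h then σ.parts r + 2 else
      if r = L then 1 else σ.parts r
  have hf : ∀ r, (σ.parts r ≠ 0 ∧ r < L ∧ σ.parts r % h + 1 = h ∧ f r = σ.parts r + 2) ∨
      (σ.parts r ≠ 0 ∧ r < L ∧ σ.parts r % h + 1 ≠ h ∧ f r = σ.parts r) ∨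
      (r = L ∧ σ.parts r = 0 ∧ f r = 1) ∨ (L < r ∧ σ.parts r = 0 ∧ f r = 0) := by
    intro r
    rcases lt_trichotomy r L with hr | hr | hr
    · have := hLmin r hr
      by_cases hm : σ.parts r % h + 1 = h
      · left; exact ⟨this, hr, hm, by simp [f, hm]⟩
      · right; left; exact ⟨this, hr, hm, by simp [f, hm]; omega⟩
    · right; right; left
      refine ⟨hr, hr ▸ hL, ?_⟩
      simp only [f]
      rw [hr, hL, if_neg hz, if_pos rfl]
    · right; right; right
      have h0 := hLz r hr.le
      refine ⟨hr, h0, ?_⟩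
      simp only [f]
      rw [h0, if_neg hz, if_neg (by omega)]
  have hfs : ∀ r, f r ≠ 0 → f (r + 1) < f r := by
    intro r hr
    have a1 := hf r
    have a2 := hf (r + 1)
    by_cases h0 : σ.parts r = 0
    · omega
    · have := hstr r h0
      omega
  obtain ⟨τ, hτ⟩ := exists_mk f (by
    intro r
    by_cases h0 : f r = 0
    · have a1 := hf r
      have a2 := hf (r + 1)
      omega
    · exact (hfs r h0).le) (L + 1) (by
    intro r hr
    have a1 := hf r
    omega)
  have hS : ∀ v, SS τ v ↔ v = 1 ∨ (2 ≤ v ∧ v % h = 1 ∧ SS σ (v - 2)) ∨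
      (v % h + 1 ≠ h ∧ SS σ v) := by
    intro v
    constructor
    · rintro ⟨hv, r, hr⟩
      rw [hτ] at hr
      rcases hf r with ⟨c1, c2, c3, c4⟩ | ⟨c1, c2, c3, c4⟩ | ⟨c1, c2, c3⟩ | ⟨c1, c2, c3⟩
      · right; left
        have := m2 _ c3
        rw [← hr, c4]
        exact ⟨by omega, this.2, c1, r, by omega⟩
      · right; right
        rw [← hr, c4]
        exact ⟨c3, c1, r, rfl⟩
      · left; omega
      · omega
    · rintro (hv | ⟨hv2, hm, hv, r, hr⟩ | ⟨hm, hv, r, hr⟩)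
      · refine ⟨by omega, L, ?_⟩
        rw [hτ]
        have := hf L
        omega
      · refine ⟨by omega, r, ?_⟩
        rw [hτ]
        have b2 := ms hp (v - 2)
        have b3 := ms hp (v - 2 + 1)
        rw [show v - 2 + 1 + 1 = v by omega] at b3
        have := hf r
        rw [hr] at this
        omega
      · refine ⟨hv, r, ?_⟩
        rw [hτ]
        have := hf r
        rw [hr] at this
        omega
  have hcore : Core h τ := by
    refine ⟨?_, ?_, ?_, ?_⟩
    · intro r hr
      rw [hτ] at hr ⊢
      rw [hτ]
      exact hfs r (by omega)
    · intro v hv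
      rcases (hS v).1 hv with h2 | h2 | h2
      · rw [h2]; omega
      · omega
      · exact H.nd v h2.2
    · intro v hv hlt
      have e : v % h = (v - h) % h := Nat.mod_eq_sub_mod hlt.le
      rcases (hS v).1 hv with h2 | h2 | h2
      · omega
      · rw [hS]
        by_cases hv1 : v - h = 1
        · exact Or.inl hv1
        · right; left
          have hle : h < v - h := by
            by_contra hc
            rcases (show v - h ≤ h by omega).eq_or_lt with h3 | h3
            · rw [h3, Nat.mod_self] at e
              omega
            · rw [Nat.mod_eq_of_lt h3] at e
              omega
          have hd := H.down _ h2.2.2 (by omega)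
          rw [show v - 2 - h = v - h - 2 by omega] at hd
          exact ⟨by omega, by omega, hd⟩
      · rw [hS]
        exact Or.inr (Or.inr ⟨by omega, H.down _ h2.2 hlt⟩)
    · have key : ∀ u v, u ≠ 0 → v ≠ 0 → u + v = h → SS τ u →
          (u = 1 ∧ v % h + 1 = h) ∨ (u ≠ 1 ∧ SS σ u) := by
        intro u v hu hv he hs
        rcases (hS u).1 hs with h2 | h2 | h2
        · left
          rw [Nat.mod_eq_of_lt (by omega)]
          omega
        · rw [Nat.mod_eq_of_lt (show u < h by omega)] at h2
          omega
        · right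
          refine ⟨?_, h2.2⟩
          rintro rfl
          exact h1 h2.2
      have k5 : ∀ u, SS τ u → u % h + 1 ≠ h := by
        intro u hs
        rcases (hS u).1 hs with h2 | h2 | h2
        · rw [h2]; omega
        · omega
        · exact h2.1
      intro u v hu hv he
      have k1 := key u v hu.1 hv.1 he hu
      have k2 := key v u hv.1 hu.1 (by omega) hv
      have k3 := k5 u hu
      have k4 := k5 v hv
      rcases k1 with k1 | k1
      · omega
      · rcases k2 with k2 | k2
        · omega
        · exact H.sum u v k1.2 k2.2 he
  have hle : ∀ q, σ.parts q ≤ τ.parts q := by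
    intro q
    rw [hτ]
    have := hf q
    omega
  have hpsi : psi h 0 σ = τ := by
    refine psi_up ?_ ?_ (diag_sub.2 hle)
    · rintro ⟨r, c⟩ hx
      exact h1 (remZ hh hn H hx).1
    · intro x
      refine ⟨?_, mk_add hcore.hs hle ?_ x⟩
      · intro hx
        obtain ⟨r, c⟩ := x
        refine ⟨?_, hx.2.1⟩
        obtain ⟨-, a0, a1⟩ := addZ hh hn H hx
        rw [mem_diag, hτ]
        rcases a1 with a1 | ⟨a1, a2, a3⟩
        · have hne : σ.parts r ≠ 0 := by
            intro h0; rw [h0] at a1; exact hz a1.1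
          have := hf r
          omega
        · have hrL : ¬ L < r := fun hc => a3 L hc hL
          have := hf r
          omega
      · intro q d d1 d2
        rw [cr0 hh hn]
        rw [hτ] at d2
        rcases hf q with ⟨c1, c2, c3, c4⟩ | ⟨c1, c2, c3, c4⟩ | ⟨c1, c2, c3⟩ | ⟨c1, c2, c3⟩
        · have := m2 _ c3
          rcases (show d = σ.parts q + 1 ∨ d = σ.parts q + 2 by omega) with hd | hd
          · rw [hd]; exact Or.inl this.1
          · rw [hd]; exact Or.inr this.2
        · omega
        · rw [show d = 1 by omega]; exact Or.inr e1
        · omega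
  rw [hpsi]
  refine ⟨hcore, ?_⟩
  intro τ' H' hsub hres
  have hle' := diag_sub.1 hsub.1
  have hadd : ∀ r c, σ.parts r < c → c ≤ τ'.parts r → Addable h 0 σ (r, c) := by
    intro r c h1 h2
    refine mk_add H'.hs hle' ?_ (r, c) ?_
    · intro q d h3 h4
      refine hres (q, d) ⟨⟨by simp only []; omega, h4⟩, ?_⟩
      rw [mem_diag]; omega
    · rw [mem_diag, mem_diag]; omega
  have hmv : ∀ r, τ'.parts r = σ.parts r ∨
      (σ.parts r % h + 1 = h ∧ τ'.parts r = σ.parts r + 2) ∨ (r = L ∧ τ'.parts r = 1) := by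
    intro r
    rcases (hle' r).eq_or_lt with h2 | h2
    · exact Or.inl h2.symm
    · right
      obtain ⟨-, a0, a1⟩ := addZ hh hn H (hadd r (τ'.parts r) h2 (le_refl _))
      rcases a1 with a1 | ⟨a1, a2, a3⟩
      · left
        refine ⟨a1.1, ?_⟩
        have := H'.nd _ ⟨show τ'.parts r ≠ 0 by omega, r, rfl⟩
        have h3 : τ'.parts r ≠ σ.parts r + 1 := by
          intro hc; rw [hc] at this; exact this (m2 _ a1.1).1
        omega
      · right
        refine ⟨?_, a2⟩
        have hrL : ¬ L < r := fun hc => a3 L hc hL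
        have : ¬ r < L := fun hc => hLmin r hc a1
        omega
  obtain ⟨r0, hr0⟩ : ∃ r, τ'.parts r ≠ σ.parts r := by
    by_contra hc
    push Not at hc
    exact hsub.2 (diag_sub.2 fun r => (hc r).le)
  have h1' : SS τ' 1 := by
    rcases (hmv r0).resolve_left hr0 with h2 | h2
    · have := (m2 _ h2.1).2
      rw [← h2.2] at this
      exact H'.c1 hp (τ'.parts r0) 1 ⟨by omega, r0, rfl⟩ (by omega) (by omega) (by omega)
    · exact ⟨by omega, r0, h2.2⟩
  have hL1 : τ'.parts L = 1 := by
    obtain ⟨-, q, hq⟩ := h1'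
    rcases hmv q with h2 | h2 | h2
    · exact (h1 ⟨by omega, q, by omega⟩).elim
    · omega
    · rw [← h2.1]; exact hq
  refine bp_ext fun r => ?_
  rw [hτ]
  have a1 := hf r
  rcases hmv r with h2 | h2 | h2
  · have a2 : r ≠ L := by rintro rfl; omega
    have a3 : σ.parts r ≠ 0 → σ.parts r % h + 1 ≠ h := by
      intro h0 hc
      apply H'.c2 hp h1' (v := σ.parts r) ⟨h0, r, h2⟩
      omega
    omega
  · have h0 : σ.parts r ≠ 0 := by
      intro h0; rw [h0] at h2; exact hz h2.1
    omega
  · have h0 : σ.parts r = 0 := by rw [h2.1]; exact hL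
    omega

end BPartition

open BPartition in
/-- For an h-bar-core σ: σ has no simultaneous addable and removable i-nodes;
ψ_i(σ) is an h-bar-core; and any h-bar-core obtained from σ by adding i-nodes
equals ψ_i(σ). -/
theorem stmt1 (n h : ℕ) (hn : 1 ≤ n) (hh : h = 2 * n + 1) (i : ℕ) (hi : i ≤ n)
    (σ : BPartition) (hσ : IsBarCore h σ) :
    (¬ ((∃ x, Addable h i σ x) ∧ (∃ x, Removable h i σ x))) ∧
    IsBarCore h (psi h i σ) ∧
    (∀ τ : BPartition, IsBarCore h τ → diagram σ ⊂ diagram τ →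
      (∀ x ∈ diagram τ \ diagram σ, colRes h x.2 = i) → τ = psi h i σ) := by
  have hp : 0 < h := by omega
  have H := core_of (by omega) hσ
  rcases Nat.eq_zero_or_pos i with h0 | h0
  · subst h0
    refine ⟨?_, ?_⟩
    · rintro ⟨⟨⟨r, c⟩, h1⟩, ⟨⟨r', c'⟩, h2⟩⟩
      exact (addZ hh hn H h1).1 (remZ hh hn H h2).1
    · by_cases h1 : SS σ 1
      · refine ⟨(zero_down hh hn H h1).isBarCore hp, ?_⟩
        intro τ hτ hsub hres
        exfalso
        have hle := diag_sub.1 hsub.1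
        obtain ⟨x, hx, hx'⟩ := Set.not_subset.1 hsub.2
        have hadd : Addable h 0 σ x :=
          ⟨hres x ⟨hx, hx'⟩, hx', τ, hτ.1, hsub.1, hx, fun y hy hy' => hres y ⟨hy, hy'⟩⟩
        obtain ⟨r, c⟩ := x
        exact (addZ hh hn H hadd).1 h1
      · obtain ⟨a, b⟩ := zero_up hh hn H h1
        exact ⟨a.isBarCore hp, fun τ hτ => b τ (core_of (by omega) hτ)⟩
  · obtain ⟨a, τ, b, c, d⟩ := pos_case hh hn h0 hi H
    rw [c]
    exact ⟨a, b.isBarCore hp, fun τ' hτ => d τ' (core_of (by omega) hτ)⟩
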